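/- Let (A,R) be a coquasitriangular Hopf algebra over k and let J : A⊗A → k be a Hopf 2-cocycle for A. Let A^J be the Hopf algebra with the same coalgebra structure as A and multiplication m^J(a⊗b) = Σ J⁻¹(a₁⊗b₁) a₂b₂ J(a₃⊗b₃). Then R^J := (J∘τ)⁻¹ ∗ R ∗ J (convolution product in (A⊗A)*, where τ is the flip) is a coquasitriangular structure on A^J, i.e. (A^J, R^J) satisfies all the coquasitriangularity axioms with respect to m^J; moreover, if (A,R) is cotriangular then so is (A^J, R^J). -/

import Mathlib

open TensorProduct LinearMap

noncomputable section

universe u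
variable {k A : Type u} [Field k] [Ring A] [HopfAlgebra k A]

/-- The convolution product on `Hom_k(A ⊗ A, k)` (using the tensor-product coalgebra
structure of `A ⊗ A`):  `(f ∗ g)(a ⊗ b) = Σ f(a₁ ⊗ b₁) g(a₂ ⊗ b₂)`. -/
def conv2 (f g : A ⊗[k] A →ₗ[k] k) : A ⊗[k] A →ₗ[k] k :=
  mul' k k ∘ₗ map f g ∘ₗ (Coalgebra.comul : A ⊗[k] A →ₗ[k] (A ⊗[k] A) ⊗[k] (A ⊗[k] A))

/-- The counit of the coalgebra `A ⊗ A`, i.e. `a ⊗ b ↦ ε(a) ε(b)`; this is the unit of the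
convolution algebra `(A ⊗ A)*`. -/
def eps2 : A ⊗[k] A →ₗ[k] k := (Coalgebra.counit : A ⊗[k] A →ₗ[k] k)

/-- The Hopf 2-cocycle identity for a linear form `J : A ⊗ A → k`:
`Σ J(a₁b₁ ⊗ c) J(a₂ ⊗ b₂) = Σ J(a ⊗ b₁c₁) J(b₂ ⊗ c₂)`, written as an equality of linear
forms on `(A ⊗ A) ⊗ A`. -/
def CocycleIdentity (J : A ⊗[k] A →ₗ[k] k) : Prop :=
  mul' k k ∘ₗ map (J ∘ₗ map (mul' k A) LinearMap.id) J ∘ₗ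
      (TensorProduct.assoc k (A ⊗[k] A) A (A ⊗[k] A)).symm.toLinearMap ∘ₗ
      map LinearMap.id (TensorProduct.comm k (A ⊗[k] A) A).toLinearMap ∘ₗ
      (TensorProduct.assoc k (A ⊗[k] A) (A ⊗[k] A) A).toLinearMap ∘ₗ
      map (Coalgebra.comul : A ⊗[k] A →ₗ[k] (A ⊗[k] A) ⊗[k] (A ⊗[k] A)) LinearMap.id =
    mul' k k ∘ₗ map (J ∘ₗ map LinearMap.id (mul' k A)) J ∘ₗ
      (TensorProduct.assoc k A (A ⊗[k] A) (A ⊗[k] A)).symm.toLinearMap ∘ₗ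
      map LinearMap.id (Coalgebra.comul : A ⊗[k] A →ₗ[k] (A ⊗[k] A) ⊗[k] (A ⊗[k] A)) ∘ₗ
      (TensorProduct.assoc k A A A).toLinearMap

/-- `J : A ⊗ A → k` is a Hopf 2-cocycle: convolution invertible, satisfies the cocycle
identity, and is normalized: `J(a ⊗ 1) = ε(a) = J(1 ⊗ a)`. -/
def IsHopf2Cocycle (J : A ⊗[k] A →ₗ[k] k) : Prop :=
  (∃ Jinv, conv2 J Jinv = eps2 ∧ conv2 Jinv J = eps2) ∧ CocycleIdentity J ∧
    (∀ a : A, J (a ⊗ₜ 1) = Coalgebra.counit a) ∧ (∀ a : A, J (1 ⊗ₜ a) = Coalgebra.counit a)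

/-- The twisted multiplication `m^J(a ⊗ b) = Σ J⁻¹(a₁ ⊗ b₁) a₂b₂ J(a₃ ⊗ b₃)`, where `Jinv`
is the convolution inverse of `J`. -/
def mJ (J Jinv : A ⊗[k] A →ₗ[k] k) : A ⊗[k] A →ₗ[k] A :=
  (TensorProduct.lid k A).toLinearMap ∘ₗ
    map Jinv ((TensorProduct.rid k A).toLinearMap ∘ₗ map (mul' k A) J) ∘ₗ
    map LinearMap.id (Coalgebra.comul : A ⊗[k] A →ₗ[k] (A ⊗[k] A) ⊗[k] (A ⊗[k] A)) ∘ₗ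
    (Coalgebra.comul : A ⊗[k] A →ₗ[k] (A ⊗[k] A) ⊗[k] (A ⊗[k] A))

/-- Coquasitriangularity of a linear form `R : A ⊗ A → k` with respect to a (possibly
twisted) multiplication `m` on the underlying coalgebra of `A` (with the same unit `1`):
`R` is convolution invertible and
`R(m(a⊗b) ⊗ c) = Σ R(a⊗c₁) R(b⊗c₂)`, `R(a ⊗ m(b⊗c)) = Σ R(a₁⊗c) R(a₂⊗b)`,
`R(a⊗1) = ε(a) = R(1⊗a)`, and `Σ m(b₁⊗a₁) R(a₂⊗b₂) = Σ R(a₁⊗b₁) m(a₂⊗b₂)`. -/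
structure IsCQT (m : A ⊗[k] A →ₗ[k] A) (R : A ⊗[k] A →ₗ[k] k) : Prop where
  conv_invertible : ∃ Rinv, conv2 R Rinv = eps2 ∧ conv2 Rinv R = eps2
  mul_left : R ∘ₗ map m LinearMap.id =
    mul' k k ∘ₗ map R R ∘ₗ (tensorTensorTensorComm k A A A A).toLinearMap ∘ₗ
      map LinearMap.id Coalgebra.comul
  mul_right : R ∘ₗ map LinearMap.id m =
    mul' k k ∘ₗ map R R ∘ₗ (tensorTensorTensorComm k A A A A).toLinearMap ∘ₗ
      map LinearMap.id (TensorProduct.comm k A A).toLinearMap ∘ₗ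
      map Coalgebra.comul LinearMap.id
  unit_right : ∀ a : A, R (a ⊗ₜ 1) = Coalgebra.counit a
  unit_left : ∀ a : A, R (1 ⊗ₜ a) = Coalgebra.counit a
  comm_rel : (TensorProduct.rid k A).toLinearMap ∘ₗ
      map (m ∘ₗ (TensorProduct.comm k A A).toLinearMap) R ∘ₗ
      (Coalgebra.comul : A ⊗[k] A →ₗ[k] (A ⊗[k] A) ⊗[k] (A ⊗[k] A)) =
    (TensorProduct.lid k A).toLinearMap ∘ₗ map R m ∘ₗ
      (Coalgebra.comul : A ⊗[k] A →ₗ[k] (A ⊗[k] A) ⊗[k] (A ⊗[k] A))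

/-- Cotriangularity: coquasitriangular, and the convolution inverse of `R` is `R ∘ τ`. -/
structure IsCT (m : A ⊗[k] A →ₗ[k] A) (R : A ⊗[k] A →ₗ[k] k) extends IsCQT m R : Prop where
  tri_right : conv2 R (R ∘ₗ (TensorProduct.comm k A A).toLinearMap) = eps2
  tri_left : conv2 (R ∘ₗ (TensorProduct.comm k A A).toLinearMap) R = eps2

section ConvolutionDual

open WithConv Coalgebra

variable {K C D E : Type*} [CommSemiring K]
  [AddCommMonoid C] [Module K C] [Coalgebra K C]
  [AddCommMonoid D] [Module K D] [Coalgebra K D]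
  [AddCommMonoid E] [Module K E] [Coalgebra K E]

/-- Precomposition with a coalgebra morphism, as a morphism of convolution monoids. -/
def convPullback (φ : C →ₗc[K] D) : WithConv (D →ₗ[K] K) →* WithConv (C →ₗ[K] K) where
  toFun f := toConv (f.ofConv ∘ₗ (φ : C →ₗ[K] D))
  map_one' := by
    ext x
    simp [LinearMap.convOne_def]
  map_mul' f g := WithConv.ext (convMul_comp_coalgHom_distrib f g φ)

theorem ofConv_convPullback (φ : C →ₗc[K] D) (f : WithConv (D →ₗ[K] K)) :
    (convPullback φ f).ofConv = f.ofConv ∘ₗ (φ : C →ₗ[K] D) := rfl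

theorem convPullback_convPullback (φ : D →ₗc[K] E) (ψ : C →ₗc[K] D) (f : WithConv (E →ₗ[K] K)) :
    convPullback ψ (convPullback φ f) = convPullback (φ.comp ψ) f := rfl

theorem map_convPullback_map_convPullback (φ : D →ₗc[K] E) (ψ : C →ₗc[K] D)
    (f : (WithConv (E →ₗ[K] K))ˣ) :
    Units.map (convPullback ψ) (Units.map (convPullback φ) f) =
      Units.map (convPullback (φ.comp ψ)) f := rfl

/-- The operator `x ↦ f(x₁) x₂`. -/
def leftAct (f : C →ₗ[K] K) : C →ₗ[K] C :=
  (TensorProduct.lid K C).toLinearMap ∘ₗ map f LinearMap.id ∘ₗ comul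

/-- The operator `x ↦ x₁ f(x₂)`. -/
def rightAct (f : C →ₗ[K] K) : C →ₗ[K] C :=
  (TensorProduct.rid K C).toLinearMap ∘ₗ map LinearMap.id f ∘ₗ comul

theorem convMul_eq_comp_leftAct (f g : C →ₗ[K] K) :
    toConv f * toConv g = toConv (g ∘ₗ leftAct f) := by
  ext x
  simp only [LinearMap.convMul_def, leftAct, LinearMap.comp_apply]
  induction comul (R := K) x <;> simp_all

theorem convMul_eq_comp_rightAct (f g : C →ₗ[K] K) :
    toConv f * toConv g = toConv (f ∘ₗ rightAct g) := by
  ext x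
  simp only [LinearMap.convMul_def, rightAct, LinearMap.comp_apply]
  induction comul (R := K) x <;> simp_all [mul_comm]

theorem leftAct_convMul (f g : WithConv (C →ₗ[K] K)) :
    leftAct (f * g).ofConv = leftAct g.ofConv ∘ₗ leftAct f.ofConv := by
  ext x
  have h := congrArg ((TensorProduct.lid K C).toLinearMap ∘ₗ map f.ofConv
    ((TensorProduct.lid K C).toLinearMap ∘ₗ map g.ofConv LinearMap.id)) (coassoc_apply x)
  convert h using 1
  · simp only [leftAct, LinearMap.comp_apply]
    generalize comul (R := K) x = t
    induction t with
    | zero => simp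
    | add s t hs ht => simp only [map_add, hs, ht]
    | tmul p q =>
      simp only [map_tmul, rTensor_tmul, LinearMap.convMul_def, LinearMap.comp_apply]
      generalize comul (R := K) p = t
      induction t with
      | zero => simp
      | add s t hs ht => simp_all [add_tmul]
      | tmul p q => simpa [mul_smul] using smul_comm _ _ _
  · simp only [leftAct, LinearMap.comp_apply]
    generalize comul (R := K) x = t
    induction t with
    | zero => simp
    | add s t hs ht => simp only [map_add, hs, ht]
    | tmul p q => simp

theorem rightAct_convMul (f g : WithConv (C →ₗ[K] K)) :
    rightAct (f * g).ofConv = rightAct f.ofConv ∘ₗ rightAct g.ofConv := by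
  ext x
  have h := congrArg ((TensorProduct.rid K C).toLinearMap ∘ₗ map LinearMap.id
    (mul' K K ∘ₗ map f.ofConv g.ofConv)) (coassoc_apply x).symm
  convert h using 1
  · simp only [rightAct, LinearMap.comp_apply]
    generalize comul (R := K) x = t
    induction t with
    | zero => simp
    | add s t hs ht => simp only [map_add, hs, ht]
    | tmul p q => simp [LinearMap.convMul_def]
  · simp only [rightAct, LinearMap.comp_apply]
    generalize comul (R := K) x = t
    induction t with
    | zero => simp
    | add s t hs ht => simp only [map_add, hs, ht]
    | tmul p q =>
      simp only [map_tmul, rTensor_tmul]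
      simp
      generalize comul (R := K) p = t
      induction t with
      | zero => simp
      | add s t hs ht => simp_all [add_tmul]
      | tmul p q => simpa [mul_smul] using smul_comm _ _ _

theorem leftAct_comp_rightAct (f g : C →ₗ[K] K) :
    leftAct f ∘ₗ rightAct g = rightAct g ∘ₗ leftAct f := by
  ext x
  have h := congrArg ((TensorProduct.lid K C).toLinearMap ∘ₗ map f
    ((TensorProduct.rid K C).toLinearMap ∘ₗ map LinearMap.id g)) (coassoc_apply x)
  convert h using 1
  · simp only [leftAct, rightAct, LinearMap.comp_apply]
    generalize comul (R := K) x = t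
    induction t with
    | zero => simp
    | add s t hs ht => simp only [map_add, hs, ht]
    | tmul p q =>
      simp
      generalize comul (R := K) p = t
      induction t with
      | zero => simp
      | add s t hs ht => simp_all [add_tmul]
      | tmul p q => simp
  · simp only [leftAct, rightAct, LinearMap.comp_apply]
    generalize comul (R := K) x = t
    induction t with
    | zero => simp
    | add s t hs ht => simp only [map_add, hs, ht]
    | tmul p q => simp

theorem comp_leftAct (φ : C →ₗc[K] D) (f : D →ₗ[K] K) :
    (φ : C →ₗ[K] D) ∘ₗ leftAct (f ∘ₗ (φ : C →ₗ[K] D)) = leftAct f ∘ₗ (φ : C →ₗ[K] D) := by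
  ext x
  simp only [leftAct, LinearMap.comp_apply, CoalgHom.coe_toLinearMap,
    ← CoalgHomClass.map_comp_comul_apply]
  induction comul (R := K) x <;> simp_all

theorem comp_rightAct (φ : C →ₗc[K] D) (f : D →ₗ[K] K) :
    (φ : C →ₗ[K] D) ∘ₗ rightAct (f ∘ₗ (φ : C →ₗ[K] D)) = rightAct f ∘ₗ (φ : C →ₗ[K] D) := by
  ext x
  simp only [rightAct, LinearMap.comp_apply, CoalgHom.coe_toLinearMap,
    ← CoalgHomClass.map_comp_comul_apply]
  induction comul (R := K) x <;> simp_all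

variable (K C D) in
/-- The flip of a tensor product of coalgebras, as a coalgebra morphism. -/
def tensorSwap : C ⊗[K] D →ₗc[K] D ⊗[K] C where
  toLinearMap := (TensorProduct.comm K C D).toLinearMap
  counit_comp := by ext; simp [mul_comm]
  map_comp_comul := by
    ext x y
    simp [← (ℛ K x).eq, ← (ℛ K y).eq, TensorProduct.sum_tmul, TensorProduct.tmul_sum]
    rw [Finset.sum_comm]

theorem tensorSwap_tmul (x : C) (y : D) : tensorSwap K C D (x ⊗ₜ y) = y ⊗ₜ x := rfl

variable (K C D) in
/-- The projection `x ⊗ y ↦ ε(y) x`, as a coalgebra morphism. -/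
def tensorFst : C ⊗[K] D →ₗc[K] C :=
  (Coalgebra.TensorProduct.rid K K C : C ⊗[K] K →ₗc[K] C).comp
    (Coalgebra.TensorProduct.map (CoalgHom.id K C) (counitCoalgHom K D))

theorem tensorFst_tmul (x : C) (y : D) : tensorFst K C D (x ⊗ₜ y) = counit (R := K) y • x := rfl

theorem Coalgebra.Repr.sum_smul_counit {ι : Type*} {x : C} (𝓡 : Coalgebra.Repr K x ι) :
    ∑ i ∈ 𝓡.index, counit (R := K) (𝓡.right i) • 𝓡.left i = x := by
  simpa only [map_sum, _root_.TensorProduct.rid_tmul, one_smul] using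
    congrArg (_root_.TensorProduct.rid K C) (sum_tmul_counit_eq 𝓡)

theorem leftAct_comp_tensorFst (f : C →ₗ[K] K) :
    leftAct (f ∘ₗ (tensorFst K C D : C ⊗[K] D →ₗ[K] C)) = map (leftAct f) LinearMap.id := by
  ext x y
  simp [leftAct, tensorFst_tmul, ← (ℛ K x).eq, ← (ℛ K y).eq, TensorProduct.sum_tmul,
    TensorProduct.tmul_sum]
  have hy := sum_counit_smul (ℛ K y)
  conv_rhs => enter [2, a]; rw [← hy, TensorProduct.tmul_sum]
  rw [Finset.sum_comm]
  exact
    Finset.sum_congr rfl fun i _ => Finset.sum_congr rfl fun j _ => by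
      simp only [← smul_tmul', tmul_smul, smul_smul, mul_comm]

theorem rightAct_comp_tensorFst (f : C →ₗ[K] K) :
    rightAct (f ∘ₗ (tensorFst K C D : C ⊗[K] D →ₗ[K] C)) = map (rightAct f) LinearMap.id := by
  ext x y
  simp [rightAct, tensorFst_tmul, ← (ℛ K x).eq, ← (ℛ K y).eq, TensorProduct.sum_tmul,
    TensorProduct.tmul_sum]
  have hy := (ℛ K y).sum_smul_counit
  conv_rhs => enter [2, a]; rw [← hy, TensorProduct.tmul_sum]
  rw [Finset.sum_comm]
  exact
    Finset.sum_congr rfl fun i _ => Finset.sum_congr rfl fun j _ => by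
      simp only [← smul_tmul', tmul_smul, smul_smul, mul_comm]

theorem map_tensorFst_swap_comp_comul :
    map (tensorFst K C D : C ⊗[K] D →ₗ[K] C)
      ((tensorFst K D C).comp (tensorSwap K C D) : C ⊗[K] D →ₗ[K] D) ∘ₗ comul = LinearMap.id := by
  ext x y
  simp [tensorFst_tmul, tensorSwap_tmul, ← (ℛ K x).eq, ← (ℛ K y).eq, TensorProduct.sum_tmul,
    TensorProduct.tmul_sum]
  have hx := (ℛ K x).sum_smul_counit
  have hy := sum_counit_smul (ℛ K y)
  conv_rhs => rw [← hx, ← hy, TensorProduct.tmul_sum]; enter [2, a]; rw [TensorProduct.sum_tmul]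
  exact
    Finset.sum_congr rfl fun i _ => Finset.sum_congr rfl fun j _ => by
      simp only [← smul_tmul', tmul_smul, smul_smul, mul_comm]

theorem map_swap_tensorFst_comp_comul :
    map ((tensorFst K D C).comp (tensorSwap K C D) : C ⊗[K] D →ₗ[K] D)
      (tensorFst K C D : C ⊗[K] D →ₗ[K] C) ∘ₗ comul = (TensorProduct.comm K C D).toLinearMap := by
  ext x y
  simp [tensorFst_tmul, tensorSwap_tmul, ← (ℛ K x).eq, ← (ℛ K y).eq, TensorProduct.sum_tmul,
    TensorProduct.tmul_sum]
  have hx := sum_counit_smul (ℛ K x)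
  have hy := (ℛ K y).sum_smul_counit
  conv_rhs => rw [← hx, ← hy, TensorProduct.sum_tmul]; enter [2, a]; rw [TensorProduct.tmul_sum]
  exact
    Finset.sum_congr rfl fun i _ => Finset.sum_congr rfl fun j _ => by
      simp only [← smul_tmul', tmul_smul, smul_smul, mul_comm]

end ConvolutionDual

section UnitTwist

/-- The monoid identity behind the hexagon axioms of a twisted braiding. -/
theorem twist_mul_twist_of_cocycle {M : Type*} [Monoid M]
    {j₁₂ j₂₃ j₃₁ j₁₃ j₃₂ x y x' y' x'' y'' : Mˣ} {r s : M}
    (h : x * j₁₂ = y * j₂₃) (h' : x' * j₃₁ = y' * j₁₂) (h'' : x'' * j₁₃ = y'' * j₃₂)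
    (hs : s * y = y'' * s) (hr : r * x'' = x' * r) :
    (↑j₁₂⁻¹ : M) * (↑y'⁻¹ * (r * s) * x) * j₁₂ =
      (↑j₃₁⁻¹ * r * j₁₃) * (↑j₃₂⁻¹ * s * j₂₃) := by
  have e₁ : (x : M) * j₁₂ = y * j₂₃ := mod_cast congrArg Units.val h
  have e₂ : (↑j₁₂⁻¹ : M) * ↑y'⁻¹ = ↑j₃₁⁻¹ * ↑x'⁻¹ := by
    have := congrArg (fun u : Mˣ => (↑u⁻¹ : M)) h'
    simpa using this.symm
  have e₃ : (↑x''⁻¹ : M) * y'' = j₁₃ * ↑j₃₂⁻¹ := by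
    have : x''⁻¹ * y'' = j₁₃ * j₃₂⁻¹ := by
      rw [inv_mul_eq_iff_eq_mul, ← mul_assoc, h'', mul_inv_cancel_right]
    exact mod_cast congrArg Units.val this
  have e₄ : (↑x'⁻¹ : M) * r = r * ↑x''⁻¹ := by
    rw [Units.inv_mul_eq_iff_eq_mul, ← mul_assoc, ← hr, Units.mul_inv_cancel_right]
  calc (↑j₁₂⁻¹ : M) * (↑y'⁻¹ * (r * s) * x) * j₁₂
      = (↑j₁₂⁻¹ * ↑y'⁻¹) * r * s * (x * j₁₂) := by simp only [mul_assoc]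
    _ = ↑j₃₁⁻¹ * (↑x'⁻¹ * r) * (s * y) * j₂₃ := by rw [e₁, e₂]; simp only [mul_assoc]
    _ = ↑j₃₁⁻¹ * r * (↑x''⁻¹ * y'') * s * j₂₃ := by rw [e₄, hs]; simp only [mul_assoc]
    _ = _ := by rw [e₃]; simp only [mul_assoc]

end UnitTwist

section TripleTensor

open WithConv Coalgebra

variable (k A)

/-- The cyclic rotation `a ⊗ b ⊗ c ↦ b ⊗ c ⊗ a`. -/
def cyc : (A ⊗[k] A) ⊗[k] A →ₗc[k] (A ⊗[k] A) ⊗[k] A :=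
  (tensorSwap k A (A ⊗[k] A)).comp
    (Coalgebra.TensorProduct.assoc k k A A A : (A ⊗[k] A) ⊗[k] A →ₗc[k] A ⊗[k] (A ⊗[k] A))

/-- The transposition `a ⊗ b ⊗ c ↦ b ⊗ a ⊗ c`. -/
def swapLeft : (A ⊗[k] A) ⊗[k] A →ₗc[k] (A ⊗[k] A) ⊗[k] A :=
  Coalgebra.TensorProduct.map (tensorSwap k A A) (CoalgHom.id k A)

/-- The transposition `a ⊗ b ⊗ c ↦ a ⊗ c ⊗ b`. -/
def swapRight : (A ⊗[k] A) ⊗[k] A →ₗc[k] (A ⊗[k] A) ⊗[k] A :=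
  (swapLeft k A).comp ((cyc k A).comp (cyc k A))

/-- The morphism `a ⊗ b ⊗ c ↦ a b ⊗ c`. -/
def mulFst : (A ⊗[k] A) ⊗[k] A →ₗc[k] A ⊗[k] A :=
  Coalgebra.TensorProduct.map (Bialgebra.mulCoalgHom k A) (CoalgHom.id k A)

/-- The morphism `a ⊗ b ⊗ c ↦ a ⊗ b c`. -/
def mulSnd : (A ⊗[k] A) ⊗[k] A →ₗc[k] A ⊗[k] A :=
  (tensorSwap k A A).comp ((mulFst k A).comp (cyc k A))

/-- The projection `a ⊗ b ⊗ c ↦ ε(c) a ⊗ b`. -/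
def proj₁₂ : (A ⊗[k] A) ⊗[k] A →ₗc[k] A ⊗[k] A := tensorFst k (A ⊗[k] A) A

/-- The projection `a ⊗ b ⊗ c ↦ ε(a) b ⊗ c`. -/
def proj₂₃ : (A ⊗[k] A) ⊗[k] A →ₗc[k] A ⊗[k] A := (proj₁₂ k A).comp (cyc k A)

/-- The projection `a ⊗ b ⊗ c ↦ ε(b) a ⊗ c`. -/
def proj₁₃ : (A ⊗[k] A) ⊗[k] A →ₗc[k] A ⊗[k] A := (proj₁₂ k A).comp (swapRight k A)

variable {k A}

theorem cyc_tmul (a b c : A) : cyc k A ((a ⊗ₜ b) ⊗ₜ c) = (b ⊗ₜ c) ⊗ₜ a := rfl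

theorem swapLeft_tmul (a b c : A) : swapLeft k A ((a ⊗ₜ b) ⊗ₜ c) = (b ⊗ₜ a) ⊗ₜ c := rfl

theorem swapRight_tmul (a b c : A) : swapRight k A ((a ⊗ₜ b) ⊗ₜ c) = (a ⊗ₜ c) ⊗ₜ b := rfl

theorem proj₁₂_tmul (a b c : A) :
    proj₁₂ k A ((a ⊗ₜ b) ⊗ₜ c) = counit (R := k) c • (a ⊗ₜ b) := rfl

theorem proj₂₃_tmul (a b c : A) :
    proj₂₃ k A ((a ⊗ₜ b) ⊗ₜ c) = counit (R := k) a • (b ⊗ₜ c) := rfl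

theorem proj₁₃_tmul (a b c : A) :
    proj₁₃ k A ((a ⊗ₜ b) ⊗ₜ c) = counit (R := k) b • (a ⊗ₜ c) := rfl

theorem coalgHom_ext_threefold {M : Type*} [AddCommMonoid M] [Module k M] [CoalgebraStruct k M]
    {φ ψ : (A ⊗[k] A) ⊗[k] A →ₗc[k] M}
    (h : ∀ a b c : A, φ ((a ⊗ₜ b) ⊗ₜ c) = ψ ((a ⊗ₜ b) ⊗ₜ c)) : φ = ψ :=
  CoalgHom.coe_linearMap_injective (TensorProduct.ext_threefold h)

/-- The form `(J ∘ τ)⁻¹ ∗ R ∗ J` obtained from `R` by twisting with a convolution unit `J`. -/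
def twistForm (u : (WithConv (A ⊗[k] A →ₗ[k] k))ˣ) (r : WithConv (A ⊗[k] A →ₗ[k] k)) :
    WithConv (A ⊗[k] A →ₗ[k] k) :=
  ↑(Units.map (convPullback (tensorSwap k A A)) u)⁻¹ * r * u

theorem convPullback_twistForm {C : Type*} [AddCommMonoid C] [Module k C] [Coalgebra k C]
    (φ : C →ₗc[k] A ⊗[k] A)
    (u : (WithConv (A ⊗[k] A →ₗ[k] k))ˣ) (r : WithConv (A ⊗[k] A →ₗ[k] k)) :
    convPullback φ (twistForm u r) =
      ↑(Units.map (convPullback ((tensorSwap k A A).comp φ)) u)⁻¹ * convPullback φ r *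
        ↑(Units.map (convPullback φ) u) := by
  simp only [twistForm, map_mul]
  rfl

theorem convMul_convPullback_proj₁₂ (φ : (A ⊗[k] A) ⊗[k] A →ₗ[k] k) (f : A ⊗[k] A →ₗ[k] k) :
    toConv φ * convPullback (proj₁₂ k A) (toConv f) =
      toConv (φ ∘ₗ map (rightAct f) LinearMap.id) := by
  rw [← rightAct_comp_tensorFst]
  exact convMul_eq_comp_rightAct _ _

theorem convPullback_proj₁₂_convMul (φ : (A ⊗[k] A) ⊗[k] A →ₗ[k] k) (f : A ⊗[k] A →ₗ[k] k) :
    convPullback (proj₁₂ k A) (toConv f) * toConv φ =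
      toConv (φ ∘ₗ map (leftAct f) LinearMap.id) := by
  rw [← leftAct_comp_tensorFst]
  exact convMul_eq_comp_leftAct _ _

/-- The cocycle identity as an identity of the convolution algebra of `A ⊗ A ⊗ A`. -/
theorem CocycleIdentity.convMul_eq {J : A ⊗[k] A →ₗ[k] k} (hJ : CocycleIdentity J) :
    convPullback (mulFst k A) (toConv J) * convPullback (proj₁₂ k A) (toConv J) =
      convPullback (mulSnd k A) (toConv J) * convPullback (proj₂₃ k A) (toConv J) := by
  have hl : convPullback (mulFst k A) (toConv J) * convPullback (proj₁₂ k A) (toConv J) =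
      toConv (J ∘ₗ map (mul' k A ∘ₗ rightAct J) LinearMap.id) := by
    refine (convMul_convPullback_proj₁₂ _ _).trans ?_
    congr 1
    ext a b c
    rfl
  have hr : convPullback (mulSnd k A) (toConv J) * convPullback (proj₂₃ k A) (toConv J) =
      toConv (J ∘ₗ map LinearMap.id (mul' k A ∘ₗ rightAct J) ∘ₗ
        (TensorProduct.assoc k A A A).toLinearMap) := by
    refine (map_mul (convPullback (cyc k A)) (convPullback
      ((tensorSwap k A A).comp (mulFst k A)) (toConv J))
        (convPullback (proj₁₂ k A) (toConv J))).symm.trans ?_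
    rw [show convPullback ((tensorSwap k A A).comp (mulFst k A)) (toConv J) =
      toConv (J ∘ₗ ((tensorSwap k A A).comp (mulFst k A) : _ →ₗ[k] _)) from rfl,
      convMul_convPullback_proj₁₂]
    refine WithConv.ext (TensorProduct.ext_threefold fun a b c => ?_)
    rfl
  rw [hl, hr]
  unfold CocycleIdentity at hJ
  convert congrArg toConv hJ using 2
  · refine TensorProduct.ext' fun x c => ?_
    simp only [rightAct, LinearMap.comp_apply, map_tmul, LinearMap.id_apply]
    generalize (comul x : (A ⊗[k] A) ⊗[k] (A ⊗[k] A)) = t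
    induction t with
    | zero => simp
    | add s t hs ht => simp_all [add_tmul]
    | tmul p q => simp [mul_comm, ← smul_tmul']
  · refine TensorProduct.ext_threefold fun a b c => ?_
    simp only [rightAct, LinearMap.comp_apply, map_tmul, LinearMap.id_apply,
      LinearEquiv.coe_coe, assoc_tmul]
    generalize (comul (b ⊗ₜ[k] c) : (A ⊗[k] A) ⊗[k] (A ⊗[k] A)) = t
    induction t with
    | zero => simp
    | add s t hs ht => simp_all [tmul_add]
    | tmul p q => simp [mul_comm]

theorem coe_proj₁₃ : (proj₁₃ k A : (A ⊗[k] A) ⊗[k] A →ₗ[k] A ⊗[k] A) =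
    map (tensorFst k A A : A ⊗[k] A →ₗ[k] A) LinearMap.id := by
  ext a b c
  exact smul_tmul' _ _ _

theorem coe_proj₂₃ : (proj₂₃ k A : (A ⊗[k] A) ⊗[k] A →ₗ[k] A ⊗[k] A) =
    map ((tensorFst k A A).comp (tensorSwap k A A) : A ⊗[k] A →ₗ[k] A) LinearMap.id := by
  ext a b c
  exact smul_tmul' _ _ _

theorem coe_proj₁₂ : (proj₁₂ k A : (A ⊗[k] A) ⊗[k] A →ₗ[k] A ⊗[k] A) =
    map LinearMap.id (tensorFst k A A : A ⊗[k] A →ₗ[k] A) ∘ₗ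
      (TensorProduct.assoc k A A A).toLinearMap := by
  ext a b c
  exact (tmul_smul _ _ _).symm

theorem coe_proj₁₃' : (proj₁₃ k A : (A ⊗[k] A) ⊗[k] A →ₗ[k] A ⊗[k] A) =
    map LinearMap.id ((tensorFst k A A).comp (tensorSwap k A A) : A ⊗[k] A →ₗ[k] A) ∘ₗ
      (TensorProduct.assoc k A A A).toLinearMap := by
  ext a b c
  exact (tmul_smul _ _ _).symm

/-- The hexagon expression `R(a ⊗ c₁) R(b ⊗ c₂)` is the convolution product `R₁₃ ∗ R₂₃`. -/
theorem proj₁₃_convMul_proj₂₃ (r : A ⊗[k] A →ₗ[k] k) :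
    convPullback (proj₁₃ k A) (toConv r) * convPullback (proj₂₃ k A) (toConv r) =
      toConv (mul' k k ∘ₗ map r r ∘ₗ (tensorTensorTensorComm k A A A A).toLinearMap ∘ₗ
        map LinearMap.id Coalgebra.comul) := by
  rw [LinearMap.convMul_def, ofConv_convPullback, ofConv_convPullback, map_comp,
    LinearMap.comp_assoc, coe_proj₁₃, coe_proj₂₃]
  congr 3
  refine TensorProduct.ext' fun x c => ?_
  have hx := LinearMap.congr_fun (map_tensorFst_swap_comp_comul (K := k) (C := A) (D := A)) x
  simp only [LinearMap.comp_apply, LinearMap.id_apply] at hx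
  simp only [LinearMap.comp_apply, comul_tmul, map_tmul, LinearMap.id_apply]
  conv_rhs => rw [← hx]
  generalize (comul x : (A ⊗[k] A) ⊗[k] (A ⊗[k] A)) = t
  generalize (comul c : A ⊗[k] A) = s
  induction t with
  | zero => simp
  | add t t' ht ht' => simp_all [add_tmul]
  | tmul p q =>
    induction s with
    | zero => simp
    | add s s' hs hs' => simp_all [tmul_add]
    | tmul c d => simp

/-- The hexagon expression `R(a₁ ⊗ c) R(a₂ ⊗ b)` is the convolution product `R₁₃ ∗ R₁₂`. -/
theorem proj₁₃_convMul_proj₁₂ (r : A ⊗[k] A →ₗ[k] k) :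
    convPullback (proj₁₃ k A) (toConv r) * convPullback (proj₁₂ k A) (toConv r) =
      toConv ((mul' k k ∘ₗ map r r ∘ₗ (tensorTensorTensorComm k A A A A).toLinearMap ∘ₗ
        map LinearMap.id (TensorProduct.comm k A A).toLinearMap ∘ₗ
        map Coalgebra.comul LinearMap.id) ∘ₗ (TensorProduct.assoc k A A A).toLinearMap) := by
  rw [LinearMap.convMul_def, ofConv_convPullback, ofConv_convPullback, map_comp,
    LinearMap.comp_assoc, coe_proj₁₃', coe_proj₁₂]
  simp only [LinearMap.comp_assoc]
  congr 3
  refine TensorProduct.ext_threefold fun a b c => ?_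
  have hx := LinearMap.congr_fun (map_swap_tensorFst_comp_comul (K := k) (C := A) (D := A))
    (b ⊗ₜ c)
  have hc : ((comul ((a ⊗ₜ[k] b) ⊗ₜ[k] c)) :
      ((A ⊗[k] A) ⊗[k] A) ⊗[k] ((A ⊗[k] A) ⊗[k] A)) =
      map (TensorProduct.assoc k A A A).symm.toLinearMap
        (TensorProduct.assoc k A A A).symm.toLinearMap
        (comul (a ⊗ₜ[k] (b ⊗ₜ[k] c))) :=
    (CoalgHomClass.map_comp_comul_apply (Coalgebra.TensorProduct.assoc k k A A A).symm
      (a ⊗ₜ[k] (b ⊗ₜ[k] c))).symm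
  simp only [LinearMap.comp_apply] at hx
  simp only [LinearMap.comp_apply, hc, LinearEquiv.coe_coe, assoc_tmul, map_tmul,
    LinearMap.id_apply]
  rw [LinearEquiv.coe_coe] at hx
  conv_rhs => rw [← hx]
  rw [comul_tmul]
  generalize (comul (b ⊗ₜ[k] c) : (A ⊗[k] A) ⊗[k] (A ⊗[k] A)) = t
  generalize (comul a : A ⊗[k] A) = s
  induction t with
  | zero => simp
  | add t t' ht ht' => simp_all [tmul_add]
  | tmul p q =>
    induction s with
    | zero => simp
    | add s s' hs hs' => simp_all [add_tmul]
    | tmul c d =>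
      simp [AlgebraTensorModule.tensorTensorTensorComm_tmul]

end TripleTensor

section Twist

open WithConv Coalgebra

theorem mJ_eq (J Jinv : A ⊗[k] A →ₗ[k] k) :
    mJ J Jinv = mul' k A ∘ₗ rightAct J ∘ₗ leftAct Jinv := by
  refine LinearMap.ext fun x => ?_
  simp only [mJ, leftAct, LinearMap.comp_apply]
  generalize (comul x : (A ⊗[k] A) ⊗[k] (A ⊗[k] A)) = t
  induction t with
  | zero => simp
  | add t t' ht ht' => simp only [map_add, ht, ht']
  | tmul p q =>
    simp only [map_tmul, LinearMap.comp_apply, LinearMap.id_apply, LinearEquiv.coe_coe, lid_tmul,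
      map_smul, rightAct]
    congr 1
    generalize (comul q : (A ⊗[k] A) ⊗[k] (A ⊗[k] A)) = t
    induction t with
    | zero => simp
    | add t t' ht ht' => simp only [map_add, ht, ht']
    | tmul p q => simp

theorem rid_comp_map_comp_comul (φ : A ⊗[k] A →ₗ[k] A) (f : A ⊗[k] A →ₗ[k] k) :
    (TensorProduct.rid k A).toLinearMap ∘ₗ map φ f ∘ₗ comul = φ ∘ₗ rightAct f := by
  refine LinearMap.ext fun x => ?_
  simp only [rightAct, LinearMap.comp_apply]
  generalize (comul x : (A ⊗[k] A) ⊗[k] (A ⊗[k] A)) = t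
  induction t <;> simp_all

theorem lid_comp_map_comp_comul (φ : A ⊗[k] A →ₗ[k] A) (f : A ⊗[k] A →ₗ[k] k) :
    (TensorProduct.lid k A).toLinearMap ∘ₗ map f φ ∘ₗ comul = φ ∘ₗ leftAct f := by
  refine LinearMap.ext fun x => ?_
  simp only [leftAct, LinearMap.comp_apply]
  generalize (comul x : (A ⊗[k] A) ⊗[k] (A ⊗[k] A)) = t
  induction t <;> simp_all

theorem IsCQT.mul_comp_comm_comp_rightAct {m : A ⊗[k] A →ₗ[k] A} {R : A ⊗[k] A →ₗ[k] k}
    (hR : IsCQT m R) :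
    (m ∘ₗ (TensorProduct.comm k A A).toLinearMap) ∘ₗ rightAct R = m ∘ₗ leftAct R := by
  rw [← rid_comp_map_comp_comul, ← lid_comp_map_comp_comul]
  exact hR.comm_rel

theorem convPullback_mulFst (F : WithConv (A ⊗[k] A →ₗ[k] k)) :
    convPullback (mulFst k A) F = toConv (F.ofConv ∘ₗ map (mul' k A) LinearMap.id) :=
  WithConv.ext (TensorProduct.ext_threefold fun _ _ _ => rfl)

theorem convPullback_mulFst_comp_swapLeft (F : WithConv (A ⊗[k] A →ₗ[k] k)) :
    convPullback ((mulFst k A).comp (swapLeft k A)) F = toConv (F.ofConv ∘ₗ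
      map (mul' k A ∘ₗ (TensorProduct.comm k A A).toLinearMap) LinearMap.id) :=
  WithConv.ext (TensorProduct.ext_threefold fun _ _ _ => rfl)

/-- `R(a₁ ⊗ b₁) F(a₂ b₂ ⊗ c) = F(b₁ a₁ ⊗ c) R(a₂ ⊗ b₂)`. -/
theorem IsCQT.braid_mulFst {R : A ⊗[k] A →ₗ[k] k} (hR : IsCQT (mul' k A) R)
    (F : WithConv (A ⊗[k] A →ₗ[k] k)) :
    convPullback (proj₁₂ k A) (toConv R) * convPullback (mulFst k A) F =
      convPullback ((mulFst k A).comp (swapLeft k A)) F *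
        convPullback (proj₁₂ k A) (toConv R) := by
  rw [convPullback_mulFst, convPullback_mulFst_comp_swapLeft, convPullback_proj₁₂_convMul,
    convMul_convPullback_proj₁₂, LinearMap.comp_assoc, LinearMap.comp_assoc, ← map_comp,
    ← map_comp, hR.mul_comp_comm_comp_rightAct]

theorem convPullback_proj₁₂_mJ (F : WithConv (A ⊗[k] A →ₗ[k] k)) (J Jinv : A ⊗[k] A →ₗ[k] k) :
    toConv (F.ofConv ∘ₗ map (mJ J Jinv) LinearMap.id) =
      convPullback (proj₁₂ k A) (toConv Jinv) * convPullback (mulFst k A) F *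
        convPullback (proj₁₂ k A) (toConv J) := by
  rw [mul_assoc, convPullback_mulFst, convMul_convPullback_proj₁₂, convPullback_proj₁₂_convMul,
    mJ_eq]
  simp only [LinearMap.comp_assoc, ← map_comp, LinearMap.id_comp]

theorem convPullback_proj₂₃_mJ (F : WithConv (A ⊗[k] A →ₗ[k] k)) (J Jinv : A ⊗[k] A →ₗ[k] k) :
    toConv (F.ofConv ∘ₗ map LinearMap.id (mJ J Jinv) ∘ₗ
        (TensorProduct.assoc k A A A).toLinearMap) =
      convPullback (proj₂₃ k A) (toConv Jinv) * convPullback (mulSnd k A) F *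
        convPullback (proj₂₃ k A) (toConv J) := by
  have h := congrArg (convPullback (cyc k A))
    (convPullback_proj₁₂_mJ (convPullback (tensorSwap k A A) F) J Jinv)
  simp only [map_mul] at h
  refine Eq.trans ?_ h
  refine WithConv.ext (TensorProduct.ext_threefold fun a b c => ?_)
  rfl

end Twist

section TwistedBraiding

open WithConv Coalgebra

theorem tensorSwap_comp_tensorSwap :
    (tensorSwap k A A).comp (tensorSwap k A A) = CoalgHom.id k (A ⊗[k] A) :=
  CoalgHom.coe_linearMap_injective (TensorProduct.ext' fun _ _ => rfl)

theorem proj₂₃_comp_cyc : (proj₂₃ k A).comp (cyc k A) = (tensorSwap k A A).comp (proj₁₃ k A) :=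
  coalgHom_ext_threefold fun a b c => by
    simp [cyc_tmul, proj₂₃_tmul, proj₁₃_tmul, tensorSwap_tmul]

theorem mulFst_comp_cyc : (mulFst k A).comp (cyc k A) = (tensorSwap k A A).comp (mulSnd k A) :=
  coalgHom_ext_threefold fun _ _ _ => rfl

theorem proj₁₂_comp_swapLeft :
    (proj₁₂ k A).comp (swapLeft k A) = (tensorSwap k A A).comp (proj₁₂ k A) :=
  coalgHom_ext_threefold fun a b c => by
    simp [swapLeft_tmul, proj₁₂_tmul, tensorSwap_tmul]

theorem proj₂₃_comp_swapLeft : (proj₂₃ k A).comp (swapLeft k A) = proj₁₃ k A :=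
  coalgHom_ext_threefold fun _ _ _ => rfl

theorem proj₂₃_comp_swapRight :
    (proj₂₃ k A).comp (swapRight k A) = (tensorSwap k A A).comp (proj₂₃ k A) :=
  coalgHom_ext_threefold fun a b c => by
    simp [swapRight_tmul, proj₂₃_tmul, tensorSwap_tmul]

theorem proj₁₂_comp_cyc_comp_cyc : (proj₁₂ k A).comp ((cyc k A).comp (cyc k A)) =
    (tensorSwap k A A).comp (proj₁₃ k A) :=
  proj₂₃_comp_cyc

theorem proj₂₃_comp_cyc_comp_cyc :
    (proj₂₃ k A).comp ((cyc k A).comp (cyc k A)) = proj₁₂ k A :=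
  coalgHom_ext_threefold fun _ _ _ => rfl

theorem mulSnd_comp_cyc_comp_cyc : (mulSnd k A).comp ((cyc k A).comp (cyc k A)) =
    (tensorSwap k A A).comp (mulFst k A) :=
  coalgHom_ext_threefold fun _ _ _ => rfl

/-- If `u` is a cocycle and `r` satisfies the first hexagon axiom and braids the multiplication,
then the twist of `r` satisfies the first hexagon axiom for the twisted multiplication. -/
theorem twistForm_hexagon_left {u : (WithConv (A ⊗[k] A →ₗ[k] k))ˣ}
    {r : WithConv (A ⊗[k] A →ₗ[k] k)}
    (hu : Units.map (convPullback (mulFst k A)) u * Units.map (convPullback (proj₁₂ k A)) u =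
      Units.map (convPullback (mulSnd k A)) u * Units.map (convPullback (proj₂₃ k A)) u)
    (hb : ∀ F : WithConv (A ⊗[k] A →ₗ[k] k),
      convPullback (proj₁₂ k A) r * convPullback (mulFst k A) F =
        convPullback ((mulFst k A).comp (swapLeft k A)) F * convPullback (proj₁₂ k A) r)
    (hr : convPullback (mulFst k A) r =
      convPullback (proj₁₃ k A) r * convPullback (proj₂₃ k A) r) :
    (↑(Units.map (convPullback (proj₁₂ k A)) u)⁻¹ : WithConv ((A ⊗[k] A) ⊗[k] A →ₗ[k] k)) *
        convPullback (mulFst k A) (twistForm u r) * ↑(Units.map (convPullback (proj₁₂ k A)) u) =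
      convPullback (proj₁₃ k A) (twistForm u r) * convPullback (proj₂₃ k A) (twistForm u r) := by
  have h₁ := congrArg (Units.map (convPullback ((cyc k A).comp (cyc k A)))) hu
  have h₂ := congrArg (Units.map (convPullback (swapRight k A))) hu
  have h₃ := congrArg (convPullback (cyc k A)) (hb (convPullback (tensorSwap k A A) ↑u))
  have h₄ := congrArg (convPullback (swapRight k A)) (hb ↑u)
  simp only [map_mul, map_convPullback_map_convPullback, proj₁₂_comp_cyc_comp_cyc,
    mulSnd_comp_cyc_comp_cyc, proj₂₃_comp_cyc_comp_cyc] at h₁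
  simp only [map_mul, map_convPullback_map_convPullback, proj₂₃_comp_swapRight] at h₂
  simp only [map_mul, convPullback_convPullback] at h₃ h₄
  rw [convPullback_twistForm, convPullback_twistForm, convPullback_twistForm, hr]
  refine twist_mul_twist_of_cocycle hu h₁ h₂ (h₃.trans ?_) (h₄.trans ?_)
  · congr 1
    exact WithConv.ext (TensorProduct.ext_threefold fun _ _ _ => rfl)
  · congr 1
    exact WithConv.ext (TensorProduct.ext_threefold fun _ _ _ => rfl)

/-- If `u` is a cocycle and `r` satisfies the second hexagon axiom and braids the multiplication,
then the twist of `r` satisfies the second hexagon axiom for the twisted multiplication. -/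
theorem twistForm_hexagon_right {u : (WithConv (A ⊗[k] A →ₗ[k] k))ˣ}
    {r : WithConv (A ⊗[k] A →ₗ[k] k)}
    (hu : Units.map (convPullback (mulFst k A)) u * Units.map (convPullback (proj₁₂ k A)) u =
      Units.map (convPullback (mulSnd k A)) u * Units.map (convPullback (proj₂₃ k A)) u)
    (hb : ∀ F : WithConv (A ⊗[k] A →ₗ[k] k),
      convPullback (proj₁₂ k A) r * convPullback (mulFst k A) F =
        convPullback ((mulFst k A).comp (swapLeft k A)) F * convPullback (proj₁₂ k A) r)
    (hr : convPullback (mulSnd k A) r =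
      convPullback (proj₁₃ k A) r * convPullback (proj₁₂ k A) r) :
    (↑(Units.map (convPullback (proj₂₃ k A)) u)⁻¹ : WithConv ((A ⊗[k] A) ⊗[k] A →ₗ[k] k)) *
        convPullback (mulSnd k A) (twistForm u r) * ↑(Units.map (convPullback (proj₂₃ k A)) u) =
      convPullback (proj₁₃ k A) (twistForm u r) * convPullback (proj₁₂ k A) (twistForm u r) := by
  have h₁ := congrArg (Units.map (convPullback (cyc k A))) hu.symm
  have h₂ := congrArg (Units.map (convPullback (swapLeft k A))) hu.symm
  have h₃ := congrArg (convPullback (swapRight k A)) (hb (convPullback (tensorSwap k A A) ↑u))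
  simp only [map_mul, map_convPullback_map_convPullback, proj₂₃_comp_cyc, mulFst_comp_cyc] at h₁
  simp only [map_mul, map_convPullback_map_convPullback, proj₂₃_comp_swapLeft,
    proj₁₂_comp_swapLeft] at h₂
  simp only [map_mul, convPullback_convPullback] at h₃
  rw [convPullback_twistForm, convPullback_twistForm, convPullback_twistForm, hr]
  refine twist_mul_twist_of_cocycle hu.symm h₁ h₂ (hb ↑u) (Eq.trans ?_ (h₃.trans ?_))
  · congr 1
    exact WithConv.ext (TensorProduct.ext_threefold fun _ _ _ => rfl)
  · congr 1
    exact WithConv.ext (TensorProduct.ext_threefold fun _ _ _ => rfl)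

variable (k A) in
/-- The morphism `a ↦ a ⊗ 1`. -/
def tmulOne : A →ₗc[k] A ⊗[k] A where
  toLinearMap := (TensorProduct.mk k A A).flip 1
  counit_comp := by ext; simp
  map_comp_comul := by
    ext a
    simp [← (ℛ k a).eq, TensorProduct.sum_tmul, Algebra.TensorProduct.one_def]

theorem convPullback_tmulOne_eq_one {f : A ⊗[k] A →ₗ[k] k}
    (hf : ∀ a, f (a ⊗ₜ 1) = counit (R := k) a) : convPullback (tmulOne k A) (toConv f) = 1 :=
  WithConv.ext (LinearMap.ext hf)

theorem convPullback_oneTmul_eq_one {f : A ⊗[k] A →ₗ[k] k}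
    (hf : ∀ a, f (1 ⊗ₜ a) = counit (R := k) a) :
    convPullback ((tensorSwap k A A).comp (tmulOne k A)) (toConv f) = 1 :=
  WithConv.ext (LinearMap.ext hf)

theorem convPullback_twistForm_eq_one {C : Type*} [AddCommMonoid C] [Module k C] [Coalgebra k C]
    {φ : C →ₗc[k] A ⊗[k] A} {u : (WithConv (A ⊗[k] A →ₗ[k] k))ˣ}
    {r : WithConv (A ⊗[k] A →ₗ[k] k)} (hu : convPullback φ ↑u = 1)
    (hu' : convPullback ((tensorSwap k A A).comp φ) ↑u = 1) (hr : convPullback φ r = 1) :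
    convPullback φ (twistForm u r) = 1 := by
  have h : Units.map (convPullback ((tensorSwap k A A).comp φ)) u = 1 := Units.ext hu'
  rw [convPullback_twistForm, hr, h, Units.coe_map, hu, inv_one, Units.val_one, mul_one, mul_one]

/-- The twist of `r` braids the twisted multiplication. -/
theorem mJ_comp_comm_comp_rightAct_twistForm
    (u : (WithConv (A ⊗[k] A →ₗ[k] k))ˣ) {r : WithConv (A ⊗[k] A →ₗ[k] k)}
    (hr : (mul' k A ∘ₗ (TensorProduct.comm k A A).toLinearMap) ∘ₗ rightAct r.ofConv =
      mul' k A ∘ₗ leftAct r.ofConv) :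
    (mJ (u : WithConv (A ⊗[k] A →ₗ[k] k)).ofConv (↑u⁻¹ : WithConv (A ⊗[k] A →ₗ[k] k)).ofConv ∘ₗ
        (TensorProduct.comm k A A).toLinearMap) ∘ₗ rightAct (twistForm u r).ofConv =
      mJ (u : WithConv (A ⊗[k] A →ₗ[k] k)).ofConv (↑u⁻¹ : WithConv (A ⊗[k] A →ₗ[k] k)).ofConv ∘ₗ
        leftAct (twistForm u r).ofConv := by
  set v := Units.map (convPullback (tensorSwap k A A)) u
  set τ := (TensorProduct.comm k A A).toLinearMap
  have hl : leftAct (↑u⁻¹ : WithConv (A ⊗[k] A →ₗ[k] k)).ofConv ∘ₗ τ =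
      τ ∘ₗ leftAct (↑v⁻¹ : WithConv (A ⊗[k] A →ₗ[k] k)).ofConv :=
    (comp_leftAct (tensorSwap k A A) _).symm
  have hρ : rightAct (u : WithConv (A ⊗[k] A →ₗ[k] k)).ofConv ∘ₗ τ =
      τ ∘ₗ rightAct (v : WithConv (A ⊗[k] A →ₗ[k] k)).ofConv :=
    (comp_rightAct (tensorSwap k A A) _).symm
  have hρv : rightAct (v : WithConv (A ⊗[k] A →ₗ[k] k)).ofConv ∘ₗ
      rightAct (twistForm u r).ofConv = rightAct r.ofConv ∘ₗ rightAct u.val.ofConv := by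
    rw [← rightAct_convMul, ← rightAct_convMul, twistForm, mul_assoc, Units.mul_inv_cancel_left]
  have hlu : leftAct (↑u⁻¹ : WithConv (A ⊗[k] A →ₗ[k] k)).ofConv ∘ₗ
      leftAct (twistForm u r).ofConv =
        leftAct r.ofConv ∘ₗ leftAct (↑v⁻¹ : WithConv (A ⊗[k] A →ₗ[k] k)).ofConv := by
    rw [← leftAct_convMul, ← leftAct_convMul, twistForm, Units.mul_inv_cancel_right]
  calc _ = mul' k A ∘ₗ rightAct u.val.ofConv ∘ₗ (leftAct u⁻¹.val.ofConv ∘ₗ τ) ∘ₗ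
        rightAct (twistForm u r).ofConv := by rw [mJ_eq]; rfl
    _ = mul' k A ∘ₗ (rightAct u.val.ofConv ∘ₗ τ) ∘ₗ leftAct v⁻¹.val.ofConv ∘ₗ
        rightAct (twistForm u r).ofConv := by rw [hl]; rfl
    _ = mul' k A ∘ₗ τ ∘ₗ (rightAct v.val.ofConv ∘ₗ rightAct (twistForm u r).ofConv) ∘ₗ
        leftAct v⁻¹.val.ofConv := by rw [hρ, leftAct_comp_rightAct]; rfl
    _ = ((mul' k A ∘ₗ τ) ∘ₗ rightAct r.ofConv) ∘ₗ rightAct u.val.ofConv ∘ₗ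
        leftAct v⁻¹.val.ofConv := by rw [hρv]; rfl
    _ = mul' k A ∘ₗ (leftAct r.ofConv ∘ₗ rightAct u.val.ofConv) ∘ₗ leftAct v⁻¹.val.ofConv := by
      rw [hr]; rfl
    _ = mul' k A ∘ₗ rightAct u.val.ofConv ∘ₗ leftAct r.ofConv ∘ₗ leftAct v⁻¹.val.ofConv := by
      rw [leftAct_comp_rightAct]; rfl
    _ = _ := by rw [← hlu, mJ_eq]; rfl

/-- The twist of a coquasitriangular structure by a Hopf 2-cocycle is a coquasitriangular
structure for the twisted multiplication. -/
theorem IsCQT.twist {R J Jinv : A ⊗[k] A →ₗ[k] k} (hR : IsCQT (mul' k A) R)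
    (hJ : IsHopf2Cocycle J) (u : (WithConv (A ⊗[k] A →ₗ[k] k))ˣ)
    (hu : u.val = toConv J) (hu' : u⁻¹.val = toConv Jinv) :
    IsCQT (mJ J Jinv) (twistForm u (toConv R)).ofConv := by
  have hcocycle : Units.map (convPullback (mulFst k A)) u *
      Units.map (convPullback (proj₁₂ k A)) u =
        Units.map (convPullback (mulSnd k A)) u * Units.map (convPullback (proj₂₃ k A)) u := by
    refine Units.ext ?_
    simp only [Units.val_mul, Units.coe_map, hu]
    exact hJ.2.1.convMul_eq
  refine ⟨?_, ?_, ?_, fun a => ?_, fun a => ?_, ?_⟩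
  · obtain ⟨Rinv, h, h'⟩ := hR.conv_invertible
    let r : (WithConv (A ⊗[k] A →ₗ[k] k))ˣ :=
      ⟨toConv R, toConv Rinv, congrArg toConv h, congrArg toConv h'⟩
    let t := (Units.map (convPullback (tensorSwap k A A)) u)⁻¹ * r * u
    exact ⟨t⁻¹.val.ofConv, congrArg ofConv t.mul_inv, congrArg ofConv t.inv_mul⟩
  · refine toConv_injective ?_
    refine Eq.trans ?_ (proj₁₃_convMul_proj₂₃ _)
    rw [convPullback_proj₁₂_mJ, ← hu, ← hu']
    refine twistForm_hexagon_left hcocycle hR.braid_mulFst ?_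
    rw [proj₁₃_convMul_proj₂₃, convPullback_mulFst]
    exact congrArg toConv hR.mul_left
  · have h := twistForm_hexagon_right hcocycle hR.braid_mulFst (by
      rw [proj₁₃_convMul_proj₁₂, ← hR.mul_right]
      exact WithConv.ext (TensorProduct.ext_threefold fun _ _ _ => rfl))
    have h' := convPullback_proj₂₃_mJ (twistForm u (toConv R)) J Jinv
    rw [← hu, ← hu'] at h'
    have h'' := congrArg ofConv ((h'.trans h).trans (proj₁₃_convMul_proj₁₂ _))
    refine TensorProduct.ext (LinearMap.ext fun a => TensorProduct.ext' fun b c => ?_)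
    exact LinearMap.congr_fun h'' ((a ⊗ₜ b) ⊗ₜ c)
  · have h := convPullback_twistForm_eq_one (φ := tmulOne k A) (u := u) (r := toConv R)
      (by rw [hu, convPullback_tmulOne_eq_one hJ.2.2.1])
      (by rw [hu, convPullback_oneTmul_eq_one hJ.2.2.2])
      (convPullback_tmulOne_eq_one hR.unit_right)
    exact LinearMap.congr_fun (congrArg ofConv h) a
  · have h := convPullback_twistForm_eq_one (φ := (tensorSwap k A A).comp (tmulOne k A))
      (u := u) (r := toConv R)
      (by rw [hu, convPullback_oneTmul_eq_one hJ.2.2.2])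
      (by rw [hu]; exact convPullback_tmulOne_eq_one hJ.2.2.1)
      (convPullback_oneTmul_eq_one hR.unit_left)
    exact LinearMap.congr_fun (congrArg ofConv h) a
  · have h := mJ_comp_comm_comp_rightAct_twistForm u hR.mul_comp_comm_comp_rightAct
    rw [rid_comp_map_comp_comul, lid_comp_map_comp_comul]
    rwa [hu, hu'] at h

theorem twistForm_mul_convPullback_tensorSwap (u : (WithConv (A ⊗[k] A →ₗ[k] k))ˣ)
    {r : WithConv (A ⊗[k] A →ₗ[k] k)} (hr : r * convPullback (tensorSwap k A A) r = 1) :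
    twistForm u r * convPullback (tensorSwap k A A) (twistForm u r) = 1 := by
  rw [convPullback_twistForm, tensorSwap_comp_tensorSwap, twistForm]
  calc _ = ↑(Units.map (convPullback (tensorSwap k A A)) u)⁻¹ * r * (u * u⁻¹.val) *
        convPullback (tensorSwap k A A) r * ↑(Units.map (convPullback (tensorSwap k A A)) u) := by
        simp only [mul_assoc]; rfl
    _ = _ := by
      simp only [Units.mul_inv, mul_one, mul_assoc _ r, hr, Units.inv_mul]

theorem convPullback_tensorSwap_mul_twistForm (u : (WithConv (A ⊗[k] A →ₗ[k] k))ˣ)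
    {r : WithConv (A ⊗[k] A →ₗ[k] k)} (hr : convPullback (tensorSwap k A A) r * r = 1) :
    convPullback (tensorSwap k A A) (twistForm u r) * twistForm u r = 1 := by
  rw [convPullback_twistForm, tensorSwap_comp_tensorSwap, twistForm]
  set v := Units.map (convPullback (tensorSwap k A A)) u
  calc _ = u⁻¹.val * convPullback (tensorSwap k A A) r * (v * v⁻¹.val) * r * u := by
        simp only [mul_assoc]; rfl
    _ = _ := by
      simp only [Units.mul_inv, mul_one, mul_assoc _ _ r, hr, Units.inv_mul]

end TwistedBraiding

section

/-- Let `(A, R)` be coquasitriangular and `J` a Hopf 2-cocycle for `A`, with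
convolution inverse `Jinv`; let `Jtinv` be the convolution inverse of `J ∘ τ`.  Then
`R^J = (J ∘ τ)⁻¹ ∗ R ∗ J` is a coquasitriangular structure for the twisted multiplication
`m^J`; moreover, if `(A, R)` is cotriangular, then so is `(A^J, R^J)`. -/
theorem statement8 {k A : Type u} [Field k] [IsAlgClosed k] [CharZero k]
    [Ring A] [HopfAlgebra k A]
    (R : A ⊗[k] A →ₗ[k] k) (hR : IsCQT (mul' k A) R)
    (J : A ⊗[k] A →ₗ[k] k) (hJ : IsHopf2Cocycle J)
    (Jinv : A ⊗[k] A →ₗ[k] k)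
    (hJinv : conv2 J Jinv = eps2 ∧ conv2 Jinv J = eps2)
    (Jtinv : A ⊗[k] A →ₗ[k] k)
    (hJtinv : conv2 (J ∘ₗ (TensorProduct.comm k A A).toLinearMap) Jtinv = eps2 ∧
      conv2 Jtinv (J ∘ₗ (TensorProduct.comm k A A).toLinearMap) = eps2) :
    IsCQT (mJ J Jinv) (conv2 (conv2 Jtinv R) J) ∧
      (IsCT (mul' k A) R → IsCT (mJ J Jinv) (conv2 (conv2 Jtinv R) J)) := by
  let u : (WithConv (A ⊗[k] A →ₗ[k] k))ˣ :=
    ⟨.toConv J, .toConv Jinv, congrArg WithConv.toConv hJinv.1, congrArg WithConv.toConv hJinv.2⟩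
  have ht : (Units.map (convPullback (tensorSwap k A A)) u)⁻¹.val = .toConv Jtinv :=
    Units.inv_eq_of_mul_eq_one_right (congrArg WithConv.toConv hJtinv.1)
  have hRJ : conv2 (conv2 Jtinv R) J = (twistForm u (.toConv R)).ofConv := by
    rw [twistForm, ht]
    rfl
  rw [hRJ]
  have h := hR.twist hJ u rfl rfl
  exact ⟨h, fun hct => ⟨h,
    congrArg WithConv.ofConv
      (twistForm_mul_convPullback_tensorSwap u (congrArg WithConv.toConv hct.tri_right)),
    congrArg WithConv.ofConv
      (convPullback_tensorSwap_mul_twistForm u (congrArg WithConv.toConv hct.tri_left))⟩⟩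

end

end
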